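/- arXiv:2605.24210 — 6 statements merged into one kernel-verified Lean document; each statement's English description precedes it below -/
import Mathlib

section
/- Let 0 < a ≤ b be real numbers, set κ = b/a, and let L be a natural number. Then there exists a real polynomial r of degree at most L with r(0) = 1 such that sup_{x ∈ [a,b]} |r(x)| ≤ 2 · ((√κ − 1)/(√κ + 1))^L. -/
open Polynomial in
/-- The Chebyshev polynomial of the first kind at the Joukowski point `(q + q⁻¹) / 2`. -/
theorem Polynomial.Chebyshev.eval_T_half_add_inv {q : ℝ} (hq : 0 < q) (n : ℕ) :
    (Chebyshev.T ℝ n).eval ((q + q⁻¹) / 2) = (q ^ n + (q ^ n)⁻¹) / 2 := by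
  rw [← Real.cosh_log hq, Chebyshev.T_real_cosh, ← Real.cosh_log (pow_pos hq n), Real.log_pow,
    Int.cast_natCast]

/-- The affine image `(b + a - 2 * x) / (b - a)` of a point of `[a, b]` lies in `[-1, 1]`. -/
theorem abs_affine_le_one {a b x : ℝ} (hab : a < b) (hx : x ∈ Set.Icc a b) :
    |-2 / (b - a) * x + (b + a) / (b - a)| ≤ 1 := by
  have h : 0 < b - a := sub_pos.2 hab
  rw [show -2 / (b - a) * x + (b + a) / (b - a) = (b + a - 2 * x) / (b - a) by ring,
    abs_div, abs_of_pos h, div_le_one h, abs_le]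
  constructor <;> linarith [hx.1, hx.2]

open Polynomial in
/-- If the affine image of `0` is the Joukowski point of `q`, the normalized Chebyshev polynomial
is bounded by `2 * q ^ L` on `[a, b]`. -/
theorem exists_residual_le_two_mul_pow {a b q : ℝ} (hab : a < b) (hq : 0 < q)
    (hz : (b + a) / (b - a) = (q + q⁻¹) / 2) (L : ℕ) :
    ∃ r : ℝ[X], r.natDegree ≤ L ∧ r.eval 0 = 1 ∧
      ∀ x ∈ Set.Icc a b, |r.eval x| ≤ 2 * q ^ L := by
  have hqL : 0 < q ^ L := pow_pos hq L
  have hT := Chebyshev.eval_T_half_add_inv hq L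
  rw [← hz] at hT
  set t := (Chebyshev.T ℝ L).eval ((b + a) / (b - a))
  have hlow : (2 * q ^ L)⁻¹ ≤ t := by
    rw [hT, mul_inv]
    linarith
  have ht : 0 < t := lt_of_lt_of_le (by positivity) hlow
  refine ⟨C t⁻¹ * (Chebyshev.T ℝ L).comp (C (-2 / (b - a)) * X + C ((b + a) / (b - a))),
    ?_, ?_, fun x hx ↦ ?_⟩
  · refine (natDegree_C_mul_le _ _).trans (natDegree_comp_le.trans ?_)
    calc _ ≤ L * 1 := Nat.mul_le_mul (by simp [Chebyshev.natDegree_T]) natDegree_linear_le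
      _ = L := mul_one L
  · simpa [t] using inv_mul_cancel₀ ht.ne'
  · have hle := Chebyshev.abs_eval_T_real_le_one L (abs_affine_le_one hab hx)
    simp only [eval_mul, eval_C, eval_comp, eval_add, eval_X, abs_mul, abs_of_pos (inv_pos.2 ht)]
    calc _ ≤ t⁻¹ * 1 := by gcongr
      _ ≤ 2 * q ^ L := by rw [mul_one]; exact inv_le_of_inv_le₀ (by positivity) hlow

/-- **Chebyshev residual polynomial bound.**
For `0 < a ≤ b`, `κ = b / a`, and any `L : ℕ`, there is a real polynomial `r` of degree at
most `L` with `r(0) = 1` and `|r(x)| ≤ 2 ((√κ - 1)/(√κ + 1))^L` for every `x ∈ [a, b]`. -/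
theorem chebyshev_residual_bound (a b : ℝ) (ha : 0 < a) (hab : a ≤ b) (L : ℕ) :
    ∃ r : Polynomial ℝ, r.natDegree ≤ L ∧ r.eval 0 = 1 ∧
      ∀ x ∈ Set.Icc a b,
        |r.eval x| ≤ 2 * ((Real.sqrt (b / a) - 1) / (Real.sqrt (b / a) + 1)) ^ L := by
  rcases hab.eq_or_lt with rfl | hlt
  · refine ⟨(Polynomial.C (-a⁻¹) * Polynomial.X + Polynomial.C 1) ^ L, ?_, by simp, ?_⟩
    · calc _ ≤ L * 1 := Polynomial.natDegree_pow_le_of_le L Polynomial.natDegree_linear_le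
        _ = L := mul_one L
    · intro x hx
      obtain rfl : x = a := le_antisymm hx.2 hx.1
      have h : (0 : ℝ) ≤ 0 ^ L := by positivity
      simp only [Polynomial.eval_pow, Polynomial.eval_add, Polynomial.eval_mul, Polynomial.eval_C,
        Polynomial.eval_X, neg_mul, inv_mul_cancel₀ ha.ne', neg_add_cancel, div_self ha.ne',
        Real.sqrt_one, sub_self, zero_div, abs_of_nonneg h]
      linarith
  · have hs : 1 < √(b / a) := by
      rw [Real.lt_sqrt zero_le_one, one_pow, one_lt_div ha]
      exact hlt
    have hb : b = √(b / a) ^ 2 * a := by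
      rw [Real.sq_sqrt (div_pos (ha.trans hlt) ha).le, div_mul_cancel₀ _ ha.ne']
    set s := √(b / a)
    have hs1 : 0 < s - 1 := sub_pos.2 hs
    refine exists_residual_le_two_mul_pow hlt (by positivity) ?_ L
    have h2 : b - a ≠ 0 := (sub_pos.2 hlt).ne'
    have h3 : s + 1 ≠ 0 := by positivity
    rw [inv_div, div_add_div _ _ h3 hs1.ne', div_div, div_eq_div_iff h2 (by positivity)]
    linear_combination -4 * hb
end

section
/- Let F : ℝⁿ → ℝ be twice continuously differentiable with ‖∇²F(y)‖ ≤ L₂ for all y with ‖y‖ ≤ 1 (operator norm of the second derivative), and let T : ℝⁿ → ℝ be a continuous linear map. If sup_{‖y‖ ≤ 1} |F(y) − T(y)| ≤ ε, then the derivative of F at 0 satisfies ‖DF(0) − T‖ ≤ 2ε + L₂/2 in the operator norm. -/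
/-- Second-order Taylor estimate: a `C²` map differs from its first-order expansion at `x` by at
most half of the squared increment times a bound of the second derivative along the segment. -/
theorem ContDiff.norm_sub_sub_fderiv_le {E G : Type*} [NormedAddCommGroup E] [NormedSpace ℝ E]
    [NormedAddCommGroup G] [NormedSpace ℝ G] {f : E → G} (hf : ContDiff ℝ 2 f) {x v : E} {C : ℝ}
    (hC : ∀ z ∈ segment ℝ x (x + v), ‖iteratedFDeriv ℝ 2 f z‖ ≤ C) :
    ‖f (x + v) - f x - fderiv ℝ f x v‖ ≤ C / 2 * ‖v‖ ^ 2 := by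
  have hdf : Differentiable ℝ f := hf.differentiable (by norm_num)
  have hddf : Differentiable ℝ (fderiv ℝ f) :=
    (hf.fderiv_right (m := 1) (by norm_num)).differentiable (by norm_num)
  have hlip (t : ℝ) (ht : t ∈ Set.Icc (0 : ℝ) 1) :
      ‖fderiv ℝ f (x + t • v) - fderiv ℝ f x‖ ≤ C * (t * ‖v‖) := by
    have hmem : x + t • v ∈ segment ℝ x (x + v) := by
      rw [segment_eq_image']
      exact ⟨t, ht, by simp⟩
    have h := (convex_segment x (x + v)).norm_image_sub_le_of_norm_fderiv_le
      (f := fderiv ℝ f) (C := C) (𝕜 := ℝ) (fun z _ ↦ hddf z)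
      (fun z hz ↦ by
        rw [← norm_iteratedFDeriv_one, norm_iteratedFDeriv_fderiv]
        exact hC z hz)
      (left_mem_segment ℝ x (x + v)) hmem
    simpa [norm_smul, abs_of_nonneg ht.1] using h
  have hderiv (t : ℝ) : HasDerivAt (fun t : ℝ ↦ f (x + t • v) - f x - t • fderiv ℝ f x v)
      (fderiv ℝ f (x + t • v) v - fderiv ℝ f x v) t := by
    have hline : HasDerivAt (fun t : ℝ ↦ x + t • v) v t := by
      simpa using ((hasDerivAt_id t).smul_const v).const_add x
    have hlin : HasDerivAt (fun t : ℝ ↦ t • fderiv ℝ f x v) (fderiv ℝ f x v) t := by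
      simpa using (hasDerivAt_id t).smul_const (fderiv ℝ f x v)
    exact (((hdf _).hasFDerivAt.comp_hasDerivAt t hline).sub_const (f x)).sub hlin
  have hbound (t : ℝ) : HasDerivAt (fun t : ℝ ↦ C / 2 * ‖v‖ ^ 2 * t ^ 2) (C * ‖v‖ ^ 2 * t) t := by
    refine ((hasDerivAt_pow 2 t).const_mul (C / 2 * ‖v‖ ^ 2)).congr_deriv ?_
    push_cast
    ring
  have h := image_norm_le_of_norm_deriv_right_le_deriv_boundary (a := (0 : ℝ)) (b := 1)
    (fun t _ ↦ (hderiv t).continuousAt.continuousWithinAt)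
    (fun t _ ↦ (hderiv t).hasDerivWithinAt) (by simp) hbound
    (fun t ht ↦ by
      rw [← sub_apply]
      calc ‖(fderiv ℝ f (x + t • v) - fderiv ℝ f x) v‖
          ≤ C * (t * ‖v‖) * ‖v‖ :=
            ContinuousLinearMap.le_of_opNorm_le _ (hlip t ⟨ht.1, ht.2.le⟩) v
        _ = C * ‖v‖ ^ 2 * t := by ring)
    (Set.right_mem_Icc.2 zero_le_one)
  simpa using h

/-- **Linearization lemma.**
Let `F : ℝⁿ → ℝ` be `C²` with `‖∇²F(y)‖ ≤ L₂` on the unit ball, and let `T` be a continuous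
linear functional.  If `|F(y) - T(y)| ≤ ε` for all `‖y‖ ≤ 1`, then the Fréchet derivative of
`F` at `0` satisfies `‖DF(0) - T‖ ≤ 2ε + L₂/2` in the operator norm. -/
theorem linearization_lemma {n : ℕ} (F : EuclideanSpace ℝ (Fin n) → ℝ)
    (T : EuclideanSpace ℝ (Fin n) →L[ℝ] ℝ) (L₂ ε : ℝ)
    (hF : ContDiff ℝ 2 F)
    (hHess : ∀ y : EuclideanSpace ℝ (Fin n), ‖y‖ ≤ 1 → ‖iteratedFDeriv ℝ 2 F y‖ ≤ L₂)
    (happrox : ∀ y : EuclideanSpace ℝ (Fin n), ‖y‖ ≤ 1 → |F y - T y| ≤ ε) :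
    ‖fderiv ℝ F 0 - T‖ ≤ 2 * ε + L₂ / 2 := by
  have hε : 0 ≤ ε := (abs_nonneg _).trans (happrox 0 (by simp))
  have hL : 0 ≤ L₂ := (norm_nonneg _).trans (hHess 0 (by simp))
  refine ContinuousLinearMap.opNorm_le_of_unit_norm (by positivity) fun y hy ↦ ?_
  have htaylor : ‖F (0 + y) - F 0 - fderiv ℝ F 0 y‖ ≤ L₂ / 2 * ‖y‖ ^ 2 :=
    hF.norm_sub_sub_fderiv_le fun z hz ↦ hHess z <| by
      have hball : z ∈ Metric.closedBall (0 : EuclideanSpace ℝ (Fin n)) 1 :=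
        (convex_closedBall _ _).segment_subset (by simp) (by simp [hy]) hz
      simpa using hball
  have hy' := happrox y hy.le
  have h0 := happrox 0 (by simp)
  rw [zero_add, hy, Real.norm_eq_abs] at htaylor
  rw [map_zero] at h0
  rw [sub_apply, Real.norm_eq_abs]
  rw [abs_le] at *
  constructor <;> linarith
end

section
/- Let v ∈ ℝⁿ be a unit vector, and for μ ∈ ℝ define K_μ = I + (μ − 1) vvᵀ. Let u, w ∈ ℝⁿ, let C₀, C₁, …, C_k be n×n real matrices, and let m₁, …, m_k be natural numbers with m₁ + ⋯ + m_k ≤ M. Then there exists a real polynomial p of degree at most M such that for all μ ∈ ℝ, uᵀ (C₀ K_μ^{m₁} C₁ K_μ^{m₂} ⋯ K_μ^{m_k} C_k) w = p(μ). -/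
open Matrix

/-- Every entry of the matrix-valued function `F` is a polynomial function of degree at most
`d`. -/
def HasPolynomialEntries {R ι : Type*} [CommRing R] (d : ℕ) (F : R → Matrix ι ι R) : Prop :=
  ∀ i j, ∃ p : Polynomial R, p.natDegree ≤ d ∧ ∀ x, F x i j = p.eval x

namespace HasPolynomialEntries

variable {R ι : Type*} [CommRing R]

theorem const (A : Matrix ι ι R) : HasPolynomialEntries 0 fun _ : R => A := fun i j =>
  ⟨Polynomial.C (A i j), by simp, by simp⟩

theorem add_sub_one_smul (A B : Matrix ι ι R) :
    HasPolynomialEntries 1 fun x : R => A + (x - 1) • B := fun i j =>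
  ⟨Polynomial.C (A i j) + (Polynomial.X - 1) * Polynomial.C (B i j), by compute_degree, by simp⟩

variable [Fintype ι] {d e : ℕ} {F G : R → Matrix ι ι R}

theorem mul (hF : HasPolynomialEntries d F) (hG : HasPolynomialEntries e G) :
    HasPolynomialEntries (d + e) fun x => F x * G x := by
  intro i j
  choose p hp hpF using hF
  choose q hq hqG using hG
  refine ⟨∑ l, p i l * q l j, Polynomial.natDegree_sum_le_of_forall_le _ _ fun l _ =>
    Polynomial.natDegree_mul_le_of_le (hp i l) (hq l j), fun x => ?_⟩
  simp [Matrix.mul_apply, Polynomial.eval_finsetSum, hpF, hqG]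

theorem dotProduct_mulVec (hF : HasPolynomialEntries d F) (u w : ι → R) :
    ∃ p : Polynomial R, p.natDegree ≤ d ∧ ∀ x, u ⬝ᵥ (F x *ᵥ w) = p.eval x := by
  choose p hp hpF using hF
  refine ⟨∑ i, Polynomial.C (u i) * ∑ j, p i j * Polynomial.C (w j), ?_, fun x => ?_⟩
  · refine Polynomial.natDegree_sum_le_of_forall_le _ _ fun i _ =>
      (Polynomial.natDegree_C_mul_le _ _).trans ?_
    exact Polynomial.natDegree_sum_le_of_forall_le _ _ fun j _ =>
      (Polynomial.natDegree_mul_C_le _ _).trans (hp i j)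
  · simp [dotProduct, mulVec, Polynomial.eval_finsetSum, hpF]

variable [DecidableEq ι]

theorem pow (hF : HasPolynomialEntries d F) (m : ℕ) :
    HasPolynomialEntries (m * d) fun x => F x ^ m := by
  induction m with
  | zero => simpa using const (1 : Matrix ι ι R)
  | succ m ih => simpa only [pow_succ, add_mul, one_mul] using ih.mul hF

theorem prod_ofFn {k : ℕ} {m : Fin k → ℕ} {F : Fin k → R → Matrix ι ι R}
    (hF : ∀ i, HasPolynomialEntries (m i) (F i)) :
    HasPolynomialEntries (∑ i, m i) fun x => (List.ofFn fun i => F i x).prod := by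
  induction k with
  | zero => simpa using const (1 : Matrix ι ι R)
  | succ k ih =>
    simpa only [List.ofFn_succ, List.prod_cons, Fin.sum_univ_succ] using
      (hF 0).mul (ih fun i => hF i.succ)

end HasPolynomialEntries

/-- **Univariate reduction for interleaved matrix polynomials.**
Let `v` be a unit vector and `K_μ = I + (μ - 1) v vᵀ`.  For vectors `u, w`, matrices
`C₀, …, C_k`, and exponents `m₁, …, m_k` with `m₁ + ⋯ + m_k ≤ M`, there is a real
polynomial `p` of degree at most `M` with
`uᵀ (C₀ K_μ^{m₁} C₁ ⋯ K_μ^{m_k} C_k) w = p(μ)` for all `μ ∈ ℝ`. -/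
theorem univariate_reduction {n k M : ℕ} (v : Fin n → ℝ) (hv : v ⬝ᵥ v = 1)
    (u w : Fin n → ℝ) (C : Fin (k + 1) → Matrix (Fin n) (Fin n) ℝ)
    (m : Fin k → ℕ) (hm : ∑ i, m i ≤ M) :
    ∃ p : Polynomial ℝ, p.natDegree ≤ M ∧
      ∀ μ : ℝ,
        u ⬝ᵥ ((C 0 *
            (List.ofFn (fun i : Fin k =>
              ((1 : Matrix (Fin n) (Fin n) ℝ) + (μ - 1) • Matrix.vecMulVec v v) ^ (m i) *
                C i.succ)).prod) *ᵥ w) = p.eval μ := by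
  have hK := HasPolynomialEntries.add_sub_one_smul (1 : Matrix (Fin n) (Fin n) ℝ) (vecMulVec v v)
  have hfactor (i : Fin k) : HasPolynomialEntries (m i) fun μ : ℝ =>
      ((1 : Matrix (Fin n) (Fin n) ℝ) + (μ - 1) • vecMulVec v v) ^ m i * C i.succ := by
    simpa using (hK.pow (m i)).mul (.const (C i.succ))
  obtain ⟨p, hp, h⟩ :=
    ((HasPolynomialEntries.const (C 0)).mul (.prod_ofFn hfactor)).dotProduct_mulVec u w
  exact ⟨p, hp.trans (by simpa using hm), h⟩
end

section
/- Let W be an n×m real matrix with W Wᵀ = α I_n for some α > 0, and let P be an n×n real matrix that is an orthogonal projection (P = Pᵀ and P² = P) of rank at most d ≤ n. Then the squared Frobenius norms satisfy ‖(I − P) W‖_F² ≥ (1 − d/n) · ‖W‖_F², and ‖W‖_F² = α n. -/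
open Matrix

/-- The trace of an idempotent matrix over a field equals its rank. -/
theorem Matrix.trace_eq_rank_of_isIdempotentElem {ι K : Type*} [Fintype ι] [DecidableEq ι]
    [Field K] {P : Matrix ι ι K} (hP : IsIdempotentElem P) : P.trace = P.rank := by
  have hidem : IsIdempotentElem (Matrix.toLin' P) := by
    rw [IsIdempotentElem, Module.End.mul_eq_comp, ← Matrix.toLin'_mul, hP.eq]
  have hproj := LinearMap.IsIdempotentElem.isProj_range _ hidem
  rw [← Matrix.trace_toLin'_eq, hproj.trace, Matrix.toLin'_apply', Matrix.rank]

/-- **CNP Approximation Lower Bound (core projection inequality).**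
Let `W` be an `n × m` real matrix with `W Wᵀ = α I` for some `α > 0`, and let `P` be an
`n × n` orthogonal projection (`Pᵀ = P`, `P² = P`) of rank at most `d ≤ n`.  Then
`‖(I - P) W‖_F² ≥ (1 - d/n) ‖W‖_F²` and `‖W‖_F² = α n`, where the squared Frobenius norm
of `M` is `trace (M Mᵀ)`. -/
theorem cnp_projection_lower_bound {n m d : ℕ}
    (W : Matrix (Fin n) (Fin m) ℝ) (α : ℝ) (hα : 0 < α)
    (hW : W * Wᵀ = α • (1 : Matrix (Fin n) (Fin n) ℝ))
    (P : Matrix (Fin n) (Fin n) ℝ) (hPsymm : Pᵀ = P) (hPidem : P * P = P)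
    (hrank : P.rank ≤ d) (hdn : d ≤ n) :
    (1 - (d : ℝ) / n) * Matrix.trace (W * Wᵀ) ≤
        Matrix.trace (((1 - P) * W) * ((1 - P) * W)ᵀ) ∧
      Matrix.trace (W * Wᵀ) = α * n := by
  have htrace : Matrix.trace (W * Wᵀ) = α * n := by simp [hW]
  refine ⟨?_, htrace⟩
  have hresidual : ((1 - P) * W) * ((1 - P) * W)ᵀ = α • (1 - P) := by
    rw [Matrix.transpose_mul, Matrix.mul_assoc, ← Matrix.mul_assoc W, hW, Matrix.transpose_sub,
      Matrix.transpose_one, hPsymm, Matrix.smul_mul, Matrix.one_mul, Matrix.mul_smul,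
      (IsIdempotentElem.one_sub hPidem).eq]
  rw [htrace, hresidual, Matrix.trace_smul, Matrix.trace_sub, Matrix.trace_one, Fintype.card_fin,
    Matrix.trace_eq_rank_of_isIdempotentElem hPidem, smul_eq_mul]
  have hrank' : (P.rank : ℝ) ≤ d := by exact_mod_cast hrank
  have hcancel : (d : ℝ) / n * n = d :=
    div_mul_cancel_of_imp fun hn => by
      have : n = 0 := by exact_mod_cast hn
      have : d = 0 := by lia
      exact_mod_cast this
  calc (1 - (d : ℝ) / n) * (α * n) = α * (n - (d : ℝ) / n * n) := by ring
    _ = α * (n - d) := by rw [hcancel]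
    _ ≤ α * (n - P.rank) := by gcongr
end

section
/- Let p, d, n be positive natural numbers with n·p > d, and let h : ℝᵖ → ℝᵈ be a continuous function. Then there exist tuples c, c' : {1,…,n} → ℝᵖ which are distinct as multisets (i.e., there is no permutation σ of {1,…,n} with c' = c ∘ σ) such that (1/n)∑_{i=1}^n h(c(i)) = (1/n)∑_{i=1}^n h(c'(i)). -/
open MeasureTheory Metric Module
open scoped NNReal

theorem ContinuousLinearMap.exists_polynomial_eval_eq_det_one_add_smul {E : Type*}
    [NormedAddCommGroup E] [NormedSpace ℝ E] [FiniteDimensional ℝ E] (A : E →L[ℝ] E) :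
    ∃ P : Polynomial ℝ, P.natDegree ≤ finrank ℝ E ∧ ∀ t : ℝ, P.eval t = (1 + t • A).det := by
  let b := finBasis ℝ E
  let M := LinearMap.toMatrix b b (A : E →ₗ[ℝ] E)
  refine ⟨((Polynomial.X : Polynomial ℝ) • M.map Polynomial.C +
    (1 : Matrix _ _ ℝ).map Polynomial.C).det, ?_, fun t => ?_⟩
  · simpa using Polynomial.natDegree_det_X_add_C_le M 1
  · rw [ContinuousLinearMap.det, ← LinearMap.det_toMatrix b, eval_det]
    congr 1
    ext i j
    simp [M, LinearMap.toMatrix_apply, Matrix.one_apply, Finsupp.single_apply, eq_comm,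
      add_comm, mul_comm]

theorem ContinuousLinearMap.det_one_add_pos_of_norm_lt_one {E : Type*}
    [NormedAddCommGroup E] [NormedSpace ℝ E] [FiniteDimensional ℝ E] (A : E →L[ℝ] E)
    (hA : ‖A‖ < 1) : 0 < (1 + A).det := by
  have : CompleteSpace E := FiniteDimensional.complete ℝ E
  have h_ne : ∀ s ∈ Set.Icc (0 : ℝ) 1, (1 + s • A).det ≠ 0 := by
    intro s hs
    have h_lt : ‖-(s • A)‖ < 1 := by
      rw [norm_neg, norm_smul, Real.norm_of_nonneg hs.1]
      nlinarith [norm_nonneg A, hs.2]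
    have h_unit := isUnit_one_sub_of_norm_lt_one h_lt
    rw [sub_neg_eq_add] at h_unit
    exact ((h_unit.map ContinuousLinearMap.toLinearMapRingHom).map LinearMap.det).ne_zero
  have h_cont : ContinuousOn (fun s : ℝ => (1 + s • A).det) (Set.Icc 0 1) :=
    (ContinuousLinearMap.continuous_det.comp (by fun_prop)).continuousOn
  by_contra! h_le
  obtain ⟨s, hs, hs'⟩ := intermediate_value_Icc' zero_le_one h_cont
    (show (0 : ℝ) ∈ Set.Icc _ _ by
      refine ⟨by simpa using h_le, ?_⟩
      simp [ContinuousLinearMap.det])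
  exact h_ne s hs hs'

theorem LipschitzOnWith.lipschitzWith_indicator_closedBall {E : Type*}
    [NormedAddCommGroup E] [NormedSpace ℝ E] {v : E → E} {K : ℝ≥0}
    (hv : LipschitzOnWith K v (closedBall 0 1)) (hv_zero : ∀ x, ‖x‖ = 1 → v x = 0) :
    LipschitzWith K ((closedBall (0 : E) 1).indicator v) := by
  have h_cross : ∀ x ∈ closedBall (0 : E) 1, ∀ y ∉ closedBall (0 : E) 1,
      ‖v x‖ ≤ K * dist x y := by
    intro x hx y hy
    rw [mem_closedBall_zero_iff] at hx hy
    obtain ⟨q, hq, hq_norm⟩ := (convex_segment (𝕜 := ℝ) x y).isPreconnected.intermediate_value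
      (left_mem_segment ℝ x y) (right_mem_segment ℝ x y) continuous_norm.continuousOn
      (show (1 : ℝ) ∈ Set.Icc _ _ from ⟨hx, (not_le.mp hy).le⟩)
    have h := hv.dist_le_mul x (by simpa using hx) q (by simp [hq_norm])
    rw [hv_zero q hq_norm, dist_zero_right] at h
    refine h.trans (mul_le_mul_of_nonneg_left ?_ K.coe_nonneg)
    have := dist_add_dist_of_mem_segment hq
    linarith [dist_nonneg (x := q) (y := y)]
  refine LipschitzWith.of_dist_le_mul fun x y => ?_
  by_cases hx : x ∈ closedBall (0 : E) 1 <;> by_cases hy : y ∈ closedBall (0 : E) 1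
  · simpa [Set.indicator_of_mem hx, Set.indicator_of_mem hy] using hv.dist_le_mul x hx y hy
  · simpa [Set.indicator_of_mem hx, Set.indicator_of_notMem hy] using h_cross x hx y hy
  · simpa [Set.indicator_of_notMem hx, Set.indicator_of_mem hy, dist_comm x y]
      using h_cross y hy x hx
  · simp only [Set.indicator_of_notMem hx, Set.indicator_of_notMem hy, dist_self]
    positivity

section

variable {E : Type*} [NormedAddCommGroup E] [InnerProductSpace ℝ E] [FiniteDimensional ℝ E]

theorem bijective_add_smul_of_lipschitzWith {u : E → E} {K : ℝ≥0}
    (hu : LipschitzWith K u) {t : ℝ} (ht : |t| * K < 1) :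
    Function.Bijective (fun x => x + t • u x) := by
  have h_approx : ApproximatesLinearOn (fun x => x + t • u x)
      ((ContinuousLinearEquiv.refl ℝ E : E ≃L[ℝ] E) : E →L[ℝ] E) Set.univ (‖t‖₊ * K) := by
    have h_sub : (fun x => x + t • u x) -
        ⇑((ContinuousLinearEquiv.refl ℝ E : E ≃L[ℝ] E) : E →L[ℝ] E) = (t • ·) ∘ u := by
      funext x
      simp
    rw [ApproximatesLinearOn.approximatesLinearOn_iff_lipschitzOnWith, lipschitzOnWith_univ,
      h_sub]
    exact (lipschitzWith_smul t).comp hu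
  have h_lt : Subsingleton E ∨
      ‖t‖₊ * K < ‖((ContinuousLinearEquiv.refl ℝ E).symm : E →L[ℝ] E)‖₊⁻¹ := by
    rcases subsingleton_or_nontrivial E with hE | hE
    · exact Or.inl hE
    · right
      rw [← NNReal.coe_lt_coe]
      simpa using ht
  exact ⟨Set.injOn_univ.mp (h_approx.injOn h_lt), h_approx.surjective h_lt⟩

theorem integral_det_one_add_smul_fderiv_of_small [MeasurableSpace E] [BorelSpace E]
    {u : E → E} {K : ℝ≥0}
    (hu : LipschitzWith K u) (hu_zero : ∀ x ∉ ball (0 : E) 1, u x = 0)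
    (hu_diff : ∀ x ∈ ball (0 : E) 1, DifferentiableAt ℝ u x) {t : ℝ} (ht : |t| * K < 1) :
    IntegrableOn (fun x => (1 + t • fderiv ℝ u x).det) (ball 0 1) ∧
      ∫ x in ball (0 : E) 1, (1 + t • fderiv ℝ u x).det = volume.real (ball (0 : E) 1) := by
  have h_bij := bijective_add_smul_of_lipschitzWith hu ht
  have h_image : (fun x => x + t • u x) '' ball 0 1 = ball 0 1 := by
    have h_compl : (fun x => x + t • u x) '' (ball 0 1)ᶜ = (ball 0 1)ᶜ := by
      conv_rhs => rw [← Set.image_id (ball (0 : E) 1)ᶜ]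
      exact Set.image_congr fun x hx => by simp [hu_zero x hx]
    rw [Set.image_compl_eq h_bij] at h_compl
    exact compl_injective h_compl
  have h_deriv : ∀ x ∈ ball (0 : E) 1, HasFDerivWithinAt (fun x => x + t • u x)
      (1 + t • fderiv ℝ u x) (ball 0 1) x := fun x hx =>
    ((hasFDerivAt_id x).add ((hu_diff x hx).hasFDerivAt.const_smul t)).hasFDerivWithinAt
  have h_abs : ∀ x, |(1 + t • fderiv ℝ u x).det| = (1 + t • fderiv ℝ u x).det := by
    intro x
    refine abs_of_pos (ContinuousLinearMap.det_one_add_pos_of_norm_lt_one _ ?_)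
    rw [norm_smul, Real.norm_eq_abs]
    exact (mul_le_mul_of_nonneg_left (norm_fderiv_le_of_lipschitz ℝ hu)
      (abs_nonneg t)).trans_lt ht
  constructor
  · have h := (integrableOn_image_iff_integrableOn_abs_det_fderiv_smul volume
      measurableSet_ball h_deriv h_bij.1.injOn (fun _ => (1 : ℝ))).mp
      (by rw [h_image]; exact integrableOn_const measure_ball_lt_top.ne)
    simpa [h_abs] using h
  · have h := integral_image_eq_integral_abs_det_fderiv_smul volume
      measurableSet_ball h_deriv h_bij.1.injOn (fun _ => (1 : ℝ))
    rw [h_image] at h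
    simpa [h_abs] using h.symm

/-- The Jacobian of a Lipschitz perturbation of the identity supported in the unit ball has the
same integral as that of the identity. For small perturbations this is the change of variables
formula; the general case follows because the determinant is polynomial in the perturbation
parameter. -/
theorem integral_det_one_add_fderiv [MeasurableSpace E] [BorelSpace E] {u : E → E} {K : ℝ≥0}
    (hu : LipschitzWith K u) (hu_zero : ∀ x ∉ ball (0 : E) 1, u x = 0)
    (hu_diff : ∀ x ∈ ball (0 : E) 1, DifferentiableAt ℝ u x) :
    ∫ x in ball (0 : E) 1, (1 + fderiv ℝ u x).det = volume.real (ball (0 : E) 1) := by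
  let s := Finset.range (finrank ℝ E + 1)
  let v : ℕ → ℝ := fun j => j / ((finrank ℝ E + 1) * (K + 1))
  have h_den : (0 : ℝ) < (finrank ℝ E + 1) * (K + 1) := by positivity
  have hv : Set.InjOn v s := fun i _ j _ h => by
    simpa [v, div_left_inj' h_den.ne'] using h
  have h_small : ∀ j ∈ s, |v j| * K < 1 := by
    intro j hj
    have hj' : (j : ℝ) < finrank ℝ E + 1 := by
      exact_mod_cast Finset.mem_range.mp hj
    rw [abs_of_nonneg (by positivity), div_mul_eq_mul_div, div_lt_one h_den]
    nlinarith [K.coe_nonneg, (Nat.cast_nonneg j : (0 : ℝ) ≤ j)]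
  have h_sum : ∀ x, (1 + fderiv ℝ u x).det =
      ∑ j ∈ s, (1 + v j • fderiv ℝ u x).det * (Lagrange.basis s v j).eval 1 := by
    intro x
    obtain ⟨P, hP, hP'⟩ := (fderiv ℝ u x).exists_polynomial_eval_eq_det_one_add_smul
    have h_deg : P.degree < s.card := by
      refine Polynomial.degree_le_natDegree.trans_lt ?_
      simp only [s, Finset.card_range]
      exact_mod_cast Nat.lt_succ_of_le hP
    have h := congrArg (Polynomial.eval 1) (Lagrange.eq_interpolate hv h_deg)
    simpa [Lagrange.interpolate_apply, Polynomial.eval_finsetSum, hP'] using h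
  have h_one : ∑ j ∈ s, (Lagrange.basis s v j).eval 1 = 1 := by
    simpa [Polynomial.eval_finsetSum] using
      congrArg (Polynomial.eval 1) (Lagrange.sum_basis hv (by simp [s]))
  have h_int := fun j hj =>
    integral_det_one_add_smul_fderiv_of_small hu hu_zero hu_diff (h_small j hj)
  simp_rw [h_sum]
  rw [integral_finsetSum _ fun j hj => (h_int j hj).1.mul_const _]
  simp_rw [integral_mul_const]
  rw [Finset.sum_congr rfl fun j hj => by rw [(h_int j hj).2], ← Finset.mul_sum, h_one, mul_one]


theorem ContinuousLinearMap.det_eq_zero_of_inner_eq_zero {A : E →L[ℝ] E} {y : E} (hy : y ≠ 0)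
    (h : ∀ z, inner ℝ y (A z) = 0) : A.det = 0 := by
  by_contra h_det
  obtain ⟨z, hz⟩ := (LinearMap.equivOfDetNeZero (A : E →ₗ[ℝ] E) h_det).surjective y
  have hz' : A z = y := hz
  have := h z
  rw [hz', inner_self_eq_zero] at this
  exact hy this

/-- There is no `C¹` retraction of the closed unit ball onto the unit sphere. -/
theorem not_norm_add_eq_one_of_contDiffOn {v : E → E} (hv : ContDiffOn ℝ 1 v (closedBall 0 1))
    (hv_zero : ∀ x, ‖x‖ = 1 → v x = 0) : ¬ ∀ x ∈ ball (0 : E) 1, ‖x + v x‖ = 1 := by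
  intro h_norm
  borelize E
  obtain ⟨K, hK⟩ := hv.exists_lipschitzOnWith one_ne_zero (convex_closedBall 0 1)
    (isCompact_closedBall 0 1)
  set u := (closedBall (0 : E) 1).indicator v with hu_def
  have hu : LipschitzWith K u := hK.lipschitzWith_indicator_closedBall hv_zero
  have hu_zero : ∀ x ∉ ball (0 : E) 1, u x = 0 := by
    intro x hx
    by_cases hx' : x ∈ closedBall (0 : E) 1
    · rw [hu_def, Set.indicator_of_mem hx']
      exact hv_zero x (le_antisymm (by simpa using hx') (by simpa using hx))
    · exact Set.indicator_of_notMem hx' v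
  have hu_eq : ∀ x ∈ ball (0 : E) 1, u x = v x := fun x hx =>
    Set.indicator_of_mem (ball_subset_closedBall hx) v
  have hu_diff : ∀ x ∈ ball (0 : E) 1, DifferentiableAt ℝ u x := by
    intro x hx
    have h_nhds : ball (0 : E) 1 ∈ nhds x := isOpen_ball.mem_nhds hx
    refine DifferentiableAt.congr_of_eventuallyEq ?_ (Filter.eventually_of_mem h_nhds hu_eq)
    exact ((hv.differentiableOn one_ne_zero).mono ball_subset_closedBall).differentiableAt h_nhds
  have h_det : ∀ x ∈ ball (0 : E) 1, (1 + fderiv ℝ u x).det = 0 := by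
    intro x hx
    have h_one : ∀ y ∈ ball (0 : E) 1, ‖y + u y‖ = 1 := fun y hy => by
      rw [hu_eq y hy, h_norm y hy]
    refine ContinuousLinearMap.det_eq_zero_of_inner_eq_zero (y := x + u x)
      (norm_pos_iff.mp (by rw [h_one x hx]; exact one_pos)) fun z => ?_
    have h_deriv : HasFDerivAt (fun y => y + u y) (1 + fderiv ℝ u x) x :=
      (hasFDerivAt_id x).add (hu_diff x hx).hasFDerivAt
    have h_const : HasFDerivAt (fun y => ‖y + u y‖ ^ 2) (0 : E →L[ℝ] ℝ) x :=
      (hasFDerivAt_const (1 : ℝ) x).congr_of_eventuallyEq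
        (Filter.eventually_of_mem (isOpen_ball.mem_nhds hx) fun y hy => by simp [h_one y hy])
    have h_two : 2 * inner ℝ (x + u x) ((1 + fderiv ℝ u x) z) = 0 := by
      simpa only [smul_apply, zero_apply, ContinuousLinearMap.comp_apply,
        innerSL_apply_apply, smul_eq_mul, nsmul_eq_mul, Nat.cast_ofNat] using
        DFunLike.congr_fun (h_deriv.norm_sq.unique h_const) z
    linarith
  have h_int := integral_det_one_add_fderiv hu hu_zero hu_diff
  rw [setIntegral_congr_fun measurableSet_ball h_det, integral_zero] at h_int
  exact (ENNReal.toReal_pos (measure_ball_pos volume (0 : E) one_pos).ne'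
    measure_ball_lt_top.ne).ne h_int

/-- A `C¹` vector field pointing outwards on the unit sphere vanishes somewhere in the ball. -/
theorem exists_eq_zero_of_contDiff_of_inner_pos {w : E → E} (hw : ContDiff ℝ 1 w)
    (h_pos : ∀ x, ‖x‖ = 1 → 0 < inner ℝ x (w x)) : ∃ x ∈ closedBall (0 : E) 1, w x = 0 := by
  by_contra! h_ne
  let b : E → ℝ := fun x => inner ℝ x (w x)
  let D : E → ℝ := fun x => b x ^ 2 + ‖w x‖ ^ 2 * (1 - ‖x‖ ^ 2)
  let l : E → ℝ := fun x => (-b x + √(D x)) / ‖w x‖ ^ 2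
  have hw_pos : ∀ x ∈ closedBall (0 : E) 1, 0 < ‖w x‖ ^ 2 := fun x hx => by
    have := norm_pos_iff.mpr (h_ne x hx)
    positivity
  have hD : ∀ x ∈ closedBall (0 : E) 1, 0 < D x := by
    intro x hx
    have hx' := mem_closedBall_zero_iff.mp hx
    rcases hx'.eq_or_lt with h_eq | h_lt
    · have : 0 < b x := h_pos x h_eq
      simp only [D, h_eq]
      nlinarith
    · have : 0 < 1 - ‖x‖ ^ 2 := by nlinarith [norm_nonneg x]
      have := mul_pos (hw_pos x hx) this
      simp only [D]
      positivity
  have hb_smooth : ContDiff ℝ 1 b := contDiff_id.inner ℝ hw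
  have hD_smooth : ContDiff ℝ 1 D :=
    (hb_smooth.pow 2).add ((hw.norm_sq ℝ).mul (contDiff_const.sub (contDiff_id.norm_sq ℝ)))
  refine not_norm_add_eq_one_of_contDiffOn (v := fun x => l x • w x) ?_ ?_ ?_
  · exact ((hb_smooth.neg.contDiffOn.add
      (hD_smooth.contDiffOn.sqrt fun x hx => (hD x hx).ne')).div
      (hw.norm_sq ℝ).contDiffOn fun x hx => (hw_pos x hx).ne').smul hw.contDiffOn
  · intro x hx
    have : √(D x) = b x := by
      simp only [D, hx]
      rw [one_pow, sub_self, mul_zero, add_zero, Real.sqrt_sq (h_pos x hx).le]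
    simp [l, this]
  · intro x hx
    have hx' := ball_subset_closedBall hx
    have h_sqrt := Real.sq_sqrt (hD x hx').le
    have hl : l x * ‖w x‖ ^ 2 = -b x + √(D x) := div_mul_cancel₀ _ (hw_pos x hx').ne'
    have h_mul : ‖w x‖ ^ 2 * ‖x + l x • w x‖ ^ 2 = ‖w x‖ ^ 2 * 1 := by
      rw [norm_add_sq_real, inner_smul_right, norm_smul, mul_pow, Real.norm_eq_abs, sq_abs]
      change ‖w x‖ ^ 2 * (‖x‖ ^ 2 + 2 * (l x * b x) + l x ^ 2 * ‖w x‖ ^ 2) = _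
      simp only [D] at h_sqrt hl
      linear_combination (2 * b x + l x * ‖w x‖ ^ 2 + (-b x +
        √(b x ^ 2 + ‖w x‖ ^ 2 * (1 - ‖x‖ ^ 2)))) * hl + h_sqrt
    have := mul_left_cancel₀ (hw_pos x hx').ne' h_mul
    exact (pow_eq_one_iff_of_nonneg (norm_nonneg _) two_ne_zero).mp this

theorem Continuous.exists_eq_zero_of_norm_sub_lt {φ : E → E} (hφ : Continuous φ)
    (h_near : ∀ x ∈ closedBall (0 : E) 1, ‖φ x - x‖ < 1 / 2) :
    ∃ x ∈ closedBall (0 : E) 1, φ x = 0 := by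
  by_contra! h_ne
  obtain ⟨x₀, hx₀, h_min⟩ := (isCompact_closedBall (0 : E) 1).exists_isMinOn
    ⟨0, by simp⟩ hφ.norm.continuousOn
  have h_pos : 0 < min ‖φ x₀‖ (1 / 2) := lt_min (norm_pos_iff.mpr (h_ne x₀ hx₀)) (by norm_num)
  obtain ⟨w, hw, hw_near, -⟩ := hφ.exists_contDiff_approx 1
    (ε := fun _ => min ‖φ x₀‖ (1 / 2)) continuous_const fun _ => h_pos
  obtain ⟨x, hx, hx_zero⟩ := exists_eq_zero_of_contDiff_of_inner_pos hw fun x hx => by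
    have h_lt : ‖w x - x‖ < 1 := by
      have h₁ := (hw_near x).trans_le (min_le_right _ _)
      have h₂ := h_near x (by simp [hx])
      rw [dist_eq_norm] at h₁
      calc ‖w x - x‖ = ‖(w x - φ x) + (φ x - x)‖ := by abel_nf
        _ ≤ ‖w x - φ x‖ + ‖φ x - x‖ := norm_add_le _ _
        _ < 1 := by linarith
    have h_inner := neg_le_of_abs_le (abs_real_inner_le_norm x (w x - x))
    rw [inner_sub_right, real_inner_self_eq_norm_sq, hx] at h_inner
    linarith
  have h := (hw_near x).trans_le (min_le_left _ _)
  rw [hx_zero, dist_zero_left] at h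
  exact (h_min hx).not_gt h

/-- Invariance of dimension: continuous maps into a space of smaller dimension are not injective. -/
theorem Continuous.not_injective_of_finrank_lt {F : Type*} [NormedAddCommGroup F]
    [NormedSpace ℝ F] [FiniteDimensional ℝ F] (h_dim : finrank ℝ F < finrank ℝ E) {f : E → F}
    (hf : Continuous f) : ¬ Function.Injective f := by
  intro h_inj
  have : CompactSpace (closedBall (0 : E) 1) :=
    isCompact_iff_compactSpace.mp (isCompact_closedBall 0 1)
  have h_emb : Topology.IsClosedEmbedding (fun x : closedBall (0 : E) 1 => f x) :=
    (hf.comp continuous_subtype_val).isClosedEmbedding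
      (h_inj.comp Subtype.val_injective)
  have : TietzeExtension E := TietzeExtension.of_tvs ℝ
  obtain ⟨g, hg⟩ := ContinuousMap.exists_extension' h_emb
    (⟨Subtype.val, continuous_subtype_val⟩ : C(closedBall (0 : E) 1, E))
  obtain ⟨k, hk, hk_near, -⟩ := g.continuous.exists_contDiff_approx 1
    (ε := fun _ => 1 / 4) continuous_const fun _ => by norm_num
  obtain ⟨y, hy, hy_norm⟩ := (hk.dense_compl_range_of_finrank_lt_finrank h_dim).exists_dist_lt 0
    (show (0 : ℝ) < 1 / 4 by norm_num)
  obtain ⟨x, -, hx⟩ := Continuous.exists_eq_zero_of_norm_sub_lt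
    (φ := fun x => k (f x) - y) ((hk.continuous.comp hf).sub continuous_const) fun x hx => by
      have h₁ := hk_near (f x)
      have h₂ : g (f x) = x := congrFun hg ⟨x, hx⟩
      rw [h₂, dist_eq_norm] at h₁
      rw [dist_zero_left] at hy_norm
      calc ‖k (f x) - y - x‖ = ‖(k (f x) - x) - y‖ := by abel_nf
        _ ≤ ‖k (f x) - x‖ + ‖y‖ := norm_sub_le _ _
        _ < 1 / 2 := by linarith
  exact hy ⟨f x, sub_eq_zero.mp hx⟩

end

theorem eq_of_four_mul_add_arctan_eq {n : ℕ} {i j : Fin n} {a b : ℝ}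
    (h : 4 * (i : ℝ) + Real.arctan a = 4 * (j : ℝ) + Real.arctan b) : i = j := by
  have ha := Real.arctan_lt_pi_div_two a
  have ha' := Real.neg_pi_div_two_lt_arctan a
  have hb := Real.arctan_lt_pi_div_two b
  have hb' := Real.neg_pi_div_two_lt_arctan b
  have h_pi := Real.pi_lt_four
  have h₁ : (i : ℝ) < (j : ℝ) + 1 := by linarith
  have h₂ : (j : ℝ) < (i : ℝ) + 1 := by linarith
  have h₁' : (i : ℕ) < j + 1 := by exact_mod_cast h₁
  have h₂' : (j : ℕ) < i + 1 := by exact_mod_cast h₂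
  exact Fin.ext (by omega)

/-- **Existence of Collisions.**
For positive `p, d, n` with `n p > d` and any continuous `h : ℝᵖ → ℝᵈ`, there exist tuples
`c, c' : Fin n → ℝᵖ` that are distinct as multisets (no permutation carries one to the
other) yet have equal mean encodings `(1/n) ∑ᵢ h(cᵢ) = (1/n) ∑ᵢ h(c'ᵢ)`. -/
theorem existence_of_collisions {p d n : ℕ} (hp : 0 < p) (hd : 0 < d) (hn : 0 < n)
    (hnp : d < n * p) (h : (Fin p → ℝ) → (Fin d → ℝ)) (hcont : Continuous h) :
    ∃ c c' : Fin n → (Fin p → ℝ),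
      (¬ ∃ σ : Equiv.Perm (Fin n), c' = c ∘ σ) ∧
      (n : ℝ)⁻¹ • ∑ i, h (c i) = (n : ℝ)⁻¹ • ∑ i, h (c' i) := by

  let e : EuclideanSpace ℝ (Fin n × Fin p) → Fin n → Fin p → ℝ :=
    fun v i j => 4 * (i : ℝ) + Real.arctan (v (i, j))
  have he : Continuous e := continuous_pi fun i => continuous_pi fun j =>
    continuous_const.add (Real.continuous_arctan.comp (by fun_prop))
  have h_sum : Continuous fun v => ∑ i, h (e v i) :=
    continuous_finsetSum _ fun i _ => hcont.comp ((continuous_apply i).comp he)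
  have h_not := h_sum.not_injective_of_finrank_lt (by simpa using hnp)
  obtain ⟨v, w, h_eq, h_ne⟩ := Function.not_injective_iff.mp h_not
  refine ⟨e v, e w, ?_, congrArg _ h_eq⟩
  rintro ⟨σ, hσ⟩
  have h_coord : ∀ i j, e w i j = e v (σ i) j := fun i j => congrFun (congrFun hσ i) j
  have hσ_id : ∀ i, i = σ i := fun i => eq_of_four_mul_add_arctan_eq (h_coord i ⟨0, hp⟩)
  refine h_ne (PiLp.ext fun ⟨i, j⟩ => ?_)
  have h_ij := h_coord i j
  rw [← hσ_id i] at h_ij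
  exact (Real.arctan_injective (add_left_cancel h_ij)).symm
end

section
/- Let k(x, x') = exp(−(x − x')²) be the Gaussian kernel on ℝ. Consider the two context sets C = {(0, 1), (2, 1)} and C' = {(0.5, 0.5), (1.5, 1.5)} in ℝ × ℝ. Then: (i) the means of the identity encodings agree, (0 + 2)/2 = (0.5 + 1.5)/2 = 1 and (1 + 1)/2 = (0.5 + 1.5)/2 = 1; but (ii) there exists a target x_t ∈ ℝ at which the GP posterior means differ: k(x_t, X_C) K(X_C, X_C)^{-1} y_C ≠ k(x_t, X_{C'}) K(X_{C'}, X_{C'})^{-1} y_{C'}, where X_C = (0, 2), y_C = (1, 1), X_{C'} = (0.5, 1.5), y_{C'} = (0.5, 1.5), K(X, X) is the 2×2 Gram matrix [k(x_i, x_j)], and k(x_t, X) is the row vector (k(x_t, x_1), k(x_t, x_2)). -/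
open Matrix

/-- The Gaussian (RBF) kernel `k(x, x') = exp(-(x - x')²)` on `ℝ`. -/
noncomputable def gaussKernel (x y : ℝ) : ℝ := Real.exp (-(x - y) ^ 2)

/-- The 2×2 Gram matrix `[k(xᵢ, xⱼ)]` of a two-point context. -/
noncomputable def gramMatrix (X : Fin 2 → ℝ) : Matrix (Fin 2) (Fin 2) ℝ :=
  Matrix.of fun i j => gaussKernel (X i) (X j)

/-- The GP posterior mean `k(x_t, X) K(X, X)⁻¹ y` at target `x_t` given context `(X, y)`. -/
noncomputable def gpPosteriorMean (X y : Fin 2 → ℝ) (xt : ℝ) : ℝ :=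
  (fun i => gaussKernel xt (X i)) ⬝ᵥ ((gramMatrix X)⁻¹ *ᵥ y)

theorem isUnit_det_gramMatrix {X : Fin 2 → ℝ} (hX : X 0 ≠ X 1) : IsUnit (gramMatrix X).det := by
  have hpos : 0 < (X 0 - X 1) ^ 2 := sq_pos_of_ne_zero (sub_ne_zero.mpr hX)
  have hlt : Real.exp (-(X 0 - X 1) ^ 2) < 1 := Real.exp_lt_one_iff.mpr (by linarith)
  have hsymm : (X 1 - X 0) ^ 2 = (X 0 - X 1) ^ 2 := by ring
  have hdet : 0 < (gramMatrix X).det := by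
    simp only [det_fin_two, gramMatrix, gaussKernel, of_apply, sub_self, hsymm]
    norm_num
    nlinarith [Real.exp_pos (-(X 0 - X 1) ^ 2)]
  exact hdet.ne'.isUnit

/-- The posterior mean interpolates the context. -/
theorem gpPosteriorMean_apply_self {X : Fin 2 → ℝ} (hX : X 0 ≠ X 1) (y : Fin 2 → ℝ) (i : Fin 2) :
    gpPosteriorMean X y (X i) = y i := by
  change (gramMatrix X *ᵥ ((gramMatrix X)⁻¹ *ᵥ y)) i = y i
  rw [mulVec_mulVec, mul_nonsing_inv _ (isUnit_det_gramMatrix hX), one_mulVec]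

/-- The posterior mean in terms of a solution `c` of the linear system `K(X, X) c = y`. -/
theorem gpPosteriorMean_of_mulVec_eq {X y c : Fin 2 → ℝ} (hX : X 0 ≠ X 1)
    (hc : gramMatrix X *ᵥ c = y) (xt : ℝ) :
    gpPosteriorMean X y xt = (fun i => gaussKernel xt (X i)) ⬝ᵥ c := by
  rw [gpPosteriorMean, ← hc, mulVec_mulVec, nonsing_inv_mul _ (isUnit_det_gramMatrix hX),
    one_mulVec]

/-- **Two-Point Collision.**
For the contexts `C = {(0,1), (2,1)}` and `C' = {(0.5,0.5), (1.5,1.5)}`: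
(i) the mean identity encodings agree, and
(ii) there is a target `x_t` at which the Gaussian-kernel GP posterior means differ. -/
theorem two_point_collision :
    (((0 : ℝ) + 2) / 2 = ((0.5 : ℝ) + 1.5) / 2 ∧
      ((1 : ℝ) + 1) / 2 = ((0.5 : ℝ) + 1.5) / 2) ∧
    ∃ xt : ℝ,
      gpPosteriorMean ![0, 2] ![1, 1] xt ≠
        gpPosteriorMean ![0.5, 1.5] ![0.5, 1.5] xt := by
  refine ⟨by norm_num, 0.5, ?_⟩
  have hinterp : gpPosteriorMean ![0.5, 1.5] ![0.5, 1.5] 0.5 = 0.5 :=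
    gpPosteriorMean_apply_self (X := ![0.5, 1.5]) (by norm_num) ![0.5, 1.5] 0
  have hsolve : gramMatrix ![0, 2] *ᵥ (fun _ => (1 + Real.exp (-4))⁻¹) = ![1, 1] := by
    ext i
    fin_cases i <;> norm_num [gramMatrix, gaussKernel, mulVec, dotProduct] <;> field_simp
    exact add_comm _ _
  have hmean := gpPosteriorMean_of_mulVec_eq (by norm_num) hsolve 0.5
  simp only [dotProduct, Fin.sum_univ_two, gaussKernel, cons_val_zero, cons_val_one,
    ← div_eq_mul_inv, ← add_div] at hmean
  rw [hinterp, hmean]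
  refine ne_of_gt ?_
  rw [lt_div_iff₀ (by positivity)]
  have hnear := Real.add_one_le_exp (-((0.5 : ℝ) - 0) ^ 2)
  have hfar := Real.exp_pos (-((0.5 : ℝ) - 2) ^ 2)
  have hsmall : Real.exp (-4) ≤ 1 / 5 := by
    rw [Real.exp_neg, ← one_div]
    exact one_div_le_one_div_of_le (by norm_num) (by linarith [Real.add_one_le_exp (4 : ℝ)])
  norm_num at hnear hfar ⊢
  linarith
end
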